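/- For all integers d ≥ 1, n ≥ 0 and any d-contact stack S on [n], the DLU path η(S) is Λ-avoiding; that is, η(S) contains no subpath U U P D D in which the two U's lie in a common piece P_i of η(S), the two D's lie in a common piece P_j, and P starts and ends at some height h and never passes below height h. -/

import Mathlib

/-- A step of a lattice path: up `(1,1)`, down `(1,-1)`, or horizontal `(1,0)`. -/
inductive DStep : Type
  | U : DStep
  | D : DStep
  | L : DStep
  deriving DecidableEq

/-- The vertical displacement of a step. -/
def DStep.val : DStep → ℤ
  | .U => 1
  | .D => -1
  | .L => 0

/-- Total vertical displacement of a word of steps. -/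
def stepSum (w : List DStep) : ℤ := (w.map DStep.val).sum

/-- A word of the form `D^a L^b U^c` with `a + b + c = d`. -/
def IsPieceWord (d : ℕ) (p : List DStep) : Prop :=
  ∃ a b c : ℕ, a + b + c = d ∧
    p = List.replicate a DStep.D ++ List.replicate b DStep.L ++ List.replicate c DStep.U

/-- `M` is a DLU path of length `d*n` from `(0,s)` to `(d*n,t)`:
each consecutive block (piece) of `d` steps has the form `D^a L^b U^c`,
the path starts at height `s`, ends at height `t`, and never passes below the x-axis. -/
def IsDLUPath (d n s t : ℕ) (M : List DStep) : Prop :=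
  M.length = d * n ∧
  (∀ i < n, IsPieceWord d ((M.drop (d * i)).take d)) ∧
  (s : ℤ) + stepSum M = (t : ℤ) ∧
  ∀ k ≤ M.length, 0 ≤ (s : ℤ) + stepSum (M.take k)

/-- The completed path `M̂ = L^{d-s} U^s M D^t L^{d-t}`. -/
def hatPath (d s t : ℕ) (M : List DStep) : List DStep :=
  List.replicate (d - s) DStep.L ++ List.replicate s DStep.U ++ M ++
    List.replicate t DStep.D ++ List.replicate (d - t) DStep.L

/-- `w` contains a contiguous subpath `U P D` with `P ∈ {∅, L^d, L^{2d}, …, L^{(m-2)d}}`. -/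
def HasShortUD (m d : ℕ) (w : List DStep) : Prop :=
  ∃ k : ℕ, k + 2 ≤ m ∧
    ([DStep.U] ++ List.replicate (k * d) DStep.L ++ [DStep.D]) <:+: w

/-- `w` is `m`-regular: it contains no subpath `U P D` with
`P ∈ {∅, L^d, L^{2d}, …, L^{(m-2)d}}`. -/
def RegularWord (m d : ℕ) (w : List DStep) : Prop := ¬ HasShortUD m d w

/-- `w` has pattern `Λ`: it contains a contiguous subpath `U U P D D` in which the two `U`'s
lie in a common piece (block of `d` steps), the two `D`'s lie in a common piece, and `P`
starts and ends at the same height `h` and never passes below height `h`. -/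
def HasLambda (d : ℕ) (w : List DStep) : Prop :=
  ∃ pre P suf : List DStep,
    w = pre ++ [DStep.U, DStep.U] ++ P ++ [DStep.D, DStep.D] ++ suf ∧
    (pre.length + 1) % d ≠ 0 ∧
    (pre.length + P.length + 3) % d ≠ 0 ∧
    stepSum P = 0 ∧
    (∀ k ≤ P.length, 0 ≤ stepSum (P.take k))

/-- An `m`-regular `Λ`-avoiding DLU path of length `d*n` from `(0,s)` to `(d*n,t)`:
the regularity and `Λ`-avoidance conditions are imposed on the completed path `M̂`. -/
def IsGoodPath (m d n s t : ℕ) (M : List DStep) : Prop :=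
  IsDLUPath d n s t M ∧ RegularWord m d (hatPath d s t M) ∧ ¬ HasLambda d (hatPath d s t M)

/-- A prime path: an `m`-regular `Λ`-avoiding DLU path which never touches the x-axis. -/
def IsPrimePath (m d n s t : ℕ) (M : List DStep) : Prop :=
  IsGoodPath m d n s t M ∧ ∀ k ≤ M.length, 0 < (s : ℤ) + stepSum (M.take k)

/-- `g^{⟨s,t⟩}_{m,d}(dn)`: the number of `m`-regular `Λ`-avoiding DLU paths of
length `d*n` from `(0,s)` to `(d*n,t)`. -/
noncomputable def gCount (m d n s t : ℕ) : ℕ := {M : List DStep | IsGoodPath m d n s t M}.ncard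

/-- `a^{⟨s,t⟩}_{m,d}(dn)`: the number of prime `m`-regular `Λ`-avoiding DLU paths of
length `d*n` from `(0,s)` to `(d*n,t)`. -/
noncomputable def aCount (m d n s t : ℕ) : ℕ := {M : List DStep | IsPrimePath m d n s t M}.ncard

/-- The generating function `G^{⟨s,t⟩}_{m,d}(x) = Σ_{n≥0} g^{⟨s,t⟩}_{m,d}(dn) x^{dn}`. -/
noncomputable def Gps (m d s t : ℕ) : PowerSeries ℤ :=
  PowerSeries.mk fun N => if d ∣ N then (gCount m d (N / d) s t : ℤ) else 0

/-- The generating function `A^{⟨s,t⟩}_{m,d}(x) = Σ_{n≥0} a^{⟨s,t⟩}_{m,d}(dn) x^{dn}`. -/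
noncomputable def Aps (m d s t : ℕ) : PowerSeries ℤ :=
  PowerSeries.mk fun N => if d ∣ N then (aCount m d (N / d) s t : ℤ) else 0

/-- `C_{m,d}(x) = (x^{d(m-1)} - 1)/(x^d - 1) = Σ_{k=0}^{m-2} x^{dk}`. -/
noncomputable def Cps (m d : ℕ) : PowerSeries ℤ :=
  ∑ k ∈ Finset.range (m - 1), (PowerSeries.X : PowerSeries ℤ) ^ (d * k)

/-- `S` is a `d`-contact stack on `[n]`: a set of arcs `(i,j)` with `1 ≤ i < j ≤ n`,
noncrossing, in which every vertex lies in at most `d` arcs. -/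
def IsContactStack (d n : ℕ) (S : Finset (ℕ × ℕ)) : Prop :=
  (∀ p ∈ S, 1 ≤ p.1 ∧ p.1 < p.2 ∧ p.2 ≤ n) ∧
  (∀ p ∈ S, ∀ q ∈ S, ¬ (p.1 < q.1 ∧ q.1 < p.2 ∧ p.2 < q.2)) ∧
  (∀ v : ℕ, (S.filter fun p => p.1 = v ∨ p.2 = v).card ≤ d)

/-- Every arc of `S` has length at least `m`. -/
def ArcsRegular (m : ℕ) (S : Finset (ℕ × ℕ)) : Prop := ∀ p ∈ S, m ≤ p.2 - p.1

/-- `S` is an `m`-regular `d`-contact stack on `[n]`. -/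
def IsStack (m d n : ℕ) (S : Finset (ℕ × ℕ)) : Prop :=
  IsContactStack d n S ∧ ArcsRegular m S

/-- The left degree of vertex `v`: the number of arcs ending at `v`. -/
def ldeg (S : Finset (ℕ × ℕ)) (v : ℕ) : ℕ := (S.filter fun p => p.2 = v).card

/-- The right degree of vertex `v`: the number of arcs starting at `v`. -/
def rdeg (S : Finset (ℕ × ℕ)) (v : ℕ) : ℕ := (S.filter fun p => p.1 = v).card

/-- The map `η`, sending a stack `S` on `[n]` to the word `P_1 P_2 ⋯ P_n` where
`P_v = D^{ldeg v} L^{d - ldeg v - rdeg v} U^{rdeg v}`. -/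
def eta (d n : ℕ) (S : Finset (ℕ × ℕ)) : List DStep :=
  (List.range n).flatMap fun i =>
    List.replicate (ldeg S (i + 1)) DStep.D ++
      List.replicate (d - ldeg S (i + 1) - rdeg S (i + 1)) DStep.L ++
      List.replicate (rdeg S (i + 1)) DStep.U

/-- `s_{m,d}(n)`: the number of `m`-regular `d`-contact stacks on `[n]`. -/
noncomputable def sCount (m d n : ℕ) : ℕ := {S : Finset (ℕ × ℕ) | IsStack m d n S}.ncard

/-- The generating function `S_{m,d}(x) = Σ_{n≥0} s_{m,d}(n) xⁿ`. -/
noncomputable def Sps (m d : ℕ) : PowerSeries ℤ := PowerSeries.mk fun n => (sCount m d n : ℤ)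

open DStep in
/-- The piece of `eta` with index `i` (vertex `i + 1`). -/
def pieceW (d : ℕ) (S : Finset (ℕ × ℕ)) (i : ℕ) : List DStep :=
  List.replicate (ldeg S (i + 1)) DStep.D ++
      List.replicate (d - ldeg S (i + 1) - rdeg S (i + 1)) DStep.L ++
      List.replicate (rdeg S (i + 1)) DStep.U

lemma stepSum_append (a b : List DStep) : stepSum (a ++ b) = stepSum a + stepSum b := by
  simp [stepSum]

lemma stepSum_rep (k : ℕ) (x : DStep) : stepSum (List.replicate k x) = k * x.val := by
  simp [stepSum]

lemma eta_succ (d n : ℕ) (S : Finset (ℕ × ℕ)) :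
    eta d (n + 1) S = eta d n S ++ pieceW d S n := by
  simp [eta, pieceW, List.range_succ]

lemma deg_le {d n : ℕ} {S : Finset (ℕ × ℕ)} (hS : IsContactStack d n S) (v : ℕ) :
    ldeg S v + rdeg S v ≤ d := by
  refine le_trans ?_ (hS.2.2 v)
  unfold ldeg rdeg
  rw [← Finset.card_union_of_disjoint]
  · apply Finset.card_le_card
    intro p
    simp only [Finset.mem_union, Finset.mem_filter]
    tauto
  · rw [Finset.disjoint_left]
    intro p hp hq
    simp only [Finset.mem_filter] at hp hq
    have := hS.1 p hp.1
    omega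

lemma pieceW_length {d n : ℕ} {S : Finset (ℕ × ℕ)} (hS : IsContactStack d n S) (i : ℕ) :
    (pieceW d S i).length = d := by
  have := deg_le hS (i + 1)
  simp [pieceW]
  omega

lemma eta_length {d n : ℕ} {S : Finset (ℕ × ℕ)} (hS : IsContactStack d n S) (k : ℕ) :
    (eta d k S).length = d * k := by
  induction k with
  | zero => simp [eta]
  | succ k ih => rw [eta_succ, List.length_append, ih, pieceW_length hS]; ring

lemma eta_split (d : ℕ) (S : Finset (ℕ × ℕ)) (i n : ℕ) (h : i < n) :
    ∃ R, eta d n S = eta d i S ++ (pieceW d S i ++ R) := by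
  induction n with
  | zero => omega
  | succ n ih =>
    rcases Nat.lt_succ_iff_lt_or_eq.mp h with h' | h'
    · obtain ⟨R, hR⟩ := ih h'
      exact ⟨R ++ pieceW d S n, by rw [eta_succ, hR]; simp⟩
    · subst h'
      exact ⟨[], by rw [eta_succ]; simp⟩

/-- Arcs covering the point just after `v`. -/
def Hset (S : Finset (ℕ × ℕ)) (v : ℕ) : Finset (ℕ × ℕ) := S.filter fun p => p.1 ≤ v ∧ v < p.2
/-- Arcs strictly covering `v`. -/
def Mset (S : Finset (ℕ × ℕ)) (v : ℕ) : Finset (ℕ × ℕ) := S.filter fun p => p.1 < v ∧ v < p.2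

lemma Hset_eq_M_add_l {d n : ℕ} {S : Finset (ℕ × ℕ)} (hS : IsContactStack d n S) (v : ℕ) :
    (Hset S v).card = (Mset S (v + 1)).card + ldeg S (v + 1) := by
  unfold ldeg
  rw [← Finset.card_union_of_disjoint]
  · congr 1
    ext p
    simp only [Finset.mem_union, Finset.mem_filter, Hset, Mset]
    by_cases hp : p ∈ S
    · have := hS.1 p hp
      simp only [hp, true_and]
      omega
    · simp [hp]
  · rw [Finset.disjoint_left]
    intro p hp hq
    simp only [Finset.mem_filter, Mset] at hp hq
    omega

lemma Hset_eq_M_add_r {d n : ℕ} {S : Finset (ℕ × ℕ)} (hS : IsContactStack d n S) (v : ℕ) :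
    (Hset S v).card = (Mset S v).card + rdeg S v := by
  unfold rdeg
  rw [← Finset.card_union_of_disjoint]
  · congr 1
    ext p
    simp only [Finset.mem_union, Finset.mem_filter, Hset, Mset]
    by_cases hp : p ∈ S
    · have := hS.1 p hp
      simp only [hp, true_and]
      omega
    · simp [hp]
  · rw [Finset.disjoint_left]
    intro p hp hq
    simp only [Finset.mem_filter, Mset] at hp hq
    omega

lemma stepSum_eta {d n : ℕ} {S : Finset (ℕ × ℕ)} (hS : IsContactStack d n S) (k : ℕ) :
    stepSum (eta d k S) = (Hset S k).card := by
  induction k with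
  | zero =>
    have : Hset S 0 = ∅ := by
      apply Finset.filter_eq_empty_iff.mpr
      intro p hp
      have := hS.1 p hp
      omega
    simp [eta, this, stepSum]
  | succ k ih =>
    have h1 := Hset_eq_M_add_l hS k
    have h2 := Hset_eq_M_add_r hS (k + 1)
    rw [eta_succ, stepSum_append, ih, pieceW]
    simp only [stepSum_append, stepSum_rep, DStep.val]
    push_cast [h1, h2]
    ring

lemma stepSum_take {d n : ℕ} {S : Finset (ℕ × ℕ)} (hS : IsContactStack d n S) (i t : ℕ)
    (hi : i < n) (ht : t ≤ d) :
    stepSum ((eta d n S).take (d * i + t)) = (Hset S i).card - min t (ldeg S (i + 1)) +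
      ((t - (d - rdeg S (i + 1)) : ℕ) : ℤ) := by
  obtain ⟨R, hR⟩ := eta_split d S i n hi
  have hl := eta_length hS i
  have hp := pieceW_length hS i
  have hdeg := deg_le hS (i + 1)
  rw [hR, List.take_append, List.take_append, hl, hp, List.take_of_length_le (by omega)]
  have e1 : d * i + t - d * i = t := by omega
  have e2 : t - d = 0 := by omega
  rw [e1, e2, stepSum_append, stepSum_append, stepSum_eta hS, pieceW]
  simp only [List.take_append, List.take_replicate, stepSum_append, stepSum_rep, DStep.val,
    List.length_append, List.length_replicate, List.take_zero]
  simp only [stepSum, List.map_nil, List.sum_nil]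
  omega

lemma get_eta {d n : ℕ} {S : Finset (ℕ × ℕ)} (hS : IsContactStack d n S) (i t : ℕ)
    (hi : i < n) (ht : t < d) :
    (eta d n S)[d * i + t]? = if t < ldeg S (i + 1) then some DStep.D else
      if t < d - rdeg S (i + 1) then some DStep.L else some DStep.U := by
  obtain ⟨R, hR⟩ := eta_split d S i n hi
  have hl := eta_length hS i
  have hp := pieceW_length hS i
  have hdeg := deg_le hS (i + 1)
  rw [hR, List.getElem?_append_right (by omega), List.getElem?_append_left (by omega), hl]
  have e1 : d * i + t - d * i = t := by omega
  rw [e1, pieceW]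
  split_ifs with h1 h2
  · rw [List.getElem?_append_left (by simp; omega), List.getElem?_append_left (by simp; omega)]
    simp [List.getElem?_replicate, h1]
  · rw [List.getElem?_append_left (by simp; omega), List.getElem?_append_right (by simp; omega)]
    simp [List.getElem?_replicate]
    omega
  · rw [List.getElem?_append_right (by simp; omega)]
    simp [List.getElem?_replicate]
    omega

/-- The combinatorial core. -/
lemma core {d n : ℕ} {S : Finset (ℕ × ℕ)} (hS : IsContactStack d n S) (i j h : ℕ) (hij : i < j)
    (hi : (Mset S i).card + 2 ≤ h) (hj : (Mset S j).card + 2 ≤ h)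
    (hH : h ≤ (Hset S i).card) (hM : ∀ v, i < v → v < j → h ≤ (Mset S v).card) : False := by
  have key : ∀ v, i ≤ v → v < j → h ≤ (S.filter fun p => p.1 ≤ i ∧ v < p.2).card := by
    intro v hv
    induction v, hv using Nat.le_induction with
    | base => intro _; exact hH
    | succ v hv ih =>
      intro hvj
      have ih := ih (by omega)
      by_cases hex : ∃ a, a ≤ i ∧ (a, v + 1) ∈ S
      · obtain ⟨a, ha, haS⟩ := hex
        refine (hM (v + 1) (by omega) hvj).trans (Finset.card_le_card ?_)
        intro p
        simp only [Mset, Finset.mem_filter]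
        rintro ⟨hp, h1, h2⟩
        refine ⟨hp, ?_, h2⟩
        by_contra hc
        exact hS.2.1 _ haS p hp ⟨by simp; omega, by simpa using h1, by simpa using h2⟩
      · refine ih.trans (Finset.card_le_card ?_)
        intro p
        simp only [Finset.mem_filter]
        rintro ⟨hp, h1, h2⟩
        refine ⟨hp, h1, ?_⟩
        by_contra hc
        have : p.2 = v + 1 := by omega
        exact hex ⟨p.1, h1, by rw [← this]; exact hp⟩
  have hA := key (j - 1) (by omega) (by omega)
  by_cases hex : ∃ b, j < b ∧ (i, b) ∈ S
  · obtain ⟨b, hb, hbS⟩ := hex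
    have : (S.filter fun p => p.1 ≤ i ∧ j - 1 < p.2) ⊆ insert (i, j) (Mset S j) := by
      intro p
      simp only [Mset, Finset.mem_filter, Finset.mem_insert]
      rintro ⟨hp, h1, h2⟩
      by_cases hpj : j < p.2
      · exact Or.inr ⟨hp, by omega, hpj⟩
      · have h3 : p.2 = j := by omega
        by_cases hpi : p.1 = i
        · exact Or.inl (Prod.ext hpi h3)
        · exact (hS.2.1 p hp _ hbS ⟨by simp; omega, by simp; omega, by simp; omega⟩).elim
    have h1 := Finset.card_le_card this
    have h2 := Finset.card_insert_le (i, j) (Mset S j)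
    omega
  · have : (S.filter fun p => p.1 ≤ i ∧ j - 1 < p.2) ⊆ insert (i, j) (Mset S i) := by
      intro p
      simp only [Mset, Finset.mem_filter, Finset.mem_insert]
      rintro ⟨hp, h1, h2⟩
      by_cases hpi : p.1 = i
      · by_cases hpj : p.2 = j
        · exact Or.inl (Prod.ext hpi hpj)
        · exact (hex ⟨p.2, by omega, by rw [← hpi]; exact hp⟩).elim
      · exact Or.inr ⟨hp, by omega, by omega⟩
    have h1 := Finset.card_le_card this
    have h2 := Finset.card_insert_le (i, j) (Mset S i)
    omega

lemma split_pos {d x : ℕ} (hd : 1 ≤ d) (h : (x + 1) % d ≠ 0) :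
    ∃ i t, x = d * i + t ∧ t + 2 ≤ d := by
  refine ⟨x / d, x % d, (Nat.div_add_mod x d).symm, ?_⟩
  have h1 := Nat.mod_lt x hd
  by_contra hc
  apply h
  have h2 : x % d + 1 = d := by omega
  have h3 := Nat.div_add_mod x d
  have h4 : x + 1 = d * (x / d + 1) := by rw [mul_add]; omega
  rw [h4]; simp

theorem stmt3 (d n : ℕ) (hd : 1 ≤ d) (S : Finset (ℕ × ℕ))
    (hS : IsContactStack d n S) :
    ¬ HasLambda d (eta d n S) := by
  rintro ⟨pre, P, suf, hw, h1, h2, hP0, hP⟩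
  obtain ⟨i, t, hx, ht⟩ := split_pos hd h1
  obtain ⟨j, s, hy, hs⟩ := split_pos (x := pre.length + P.length + 2) hd h2
  have hlen := eta_length hS n
  have hlen2 := congrArg List.length hw
  rw [hlen] at hlen2
  simp at hlen2
  have hjn : j < n := by
    by_contra hc
    have := Nat.mul_le_mul_left d (not_lt.mp hc)
    omega
  have hij0 : i ≤ j := by
    by_contra hc
    have := Nat.mul_le_mul_left d (show j + 1 ≤ i by omega)
    rw [mul_add] at this
    omega
  have gU := get_eta hS i t (by omega) (by omega)
  have gD := get_eta hS j (s + 1) hjn (by omega)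
  have degi := deg_le hS (i + 1)
  have degj := deg_le hS (j + 1)
  have eU : (eta d n S)[d * i + t]? = some DStep.U := by
    rw [hw, ← hx]; simp
  have eD : (eta d n S)[d * j + (s + 1)]? = some DStep.D := by
    rw [hw, ← add_assoc, ← hy]
    have : pre ++ [DStep.U, DStep.U] ++ P ++ [DStep.D, DStep.D] ++ suf =
      (pre ++ [DStep.U, DStep.U] ++ P ++ [DStep.D]) ++ (DStep.D :: suf) := by simp
    rw [this, List.getElem?_append_right (by simp; omega)]
    have : pre.length + P.length + 2 + 1 -
      (pre ++ [DStep.U, DStep.U] ++ P ++ [DStep.D]).length = 0 := by simp; omega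
    rw [this]; simp
  rw [eU] at gU
  rw [eD] at gD
  have hU : d - rdeg S (i + 1) ≤ t ∧ ldeg S (i + 1) ≤ t := by
    split_ifs at gU <;> simp at gU
    omega
  have hD : s + 1 < ldeg S (j + 1) := by
    split_ifs at gD with hh hh <;> simp at gD
    exact hh
  have hij : i < j := by
    rcases Nat.lt_or_eq_of_le hij0 with h | h
    · exact h
    · subst h; omega
  -- heights
  have hpre : stepSum ((eta d n S).take (d * i + t)) = stepSum pre := by
    rw [hw, ← hx]; simp
  have hmid : ∀ k, pre.length + 2 ≤ k → k ≤ pre.length + P.length + 2 →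
      stepSum pre + 2 ≤ stepSum ((eta d n S).take k) := by
    intro k hk1 hk2
    obtain ⟨q, rfl⟩ := Nat.exists_eq_add_of_le hk1
    have e : (eta d n S).take (pre.length + 2 + q) = pre ++ ([DStep.U, DStep.U] ++ P.take q) := by
      have : pre ++ [DStep.U, DStep.U] ++ P ++ [DStep.D, DStep.D] ++ suf =
        (pre ++ [DStep.U, DStep.U]) ++ (P ++ ([DStep.D, DStep.D] ++ suf)) := by simp
      have hl : pre.length + 2 = (pre ++ [DStep.U, DStep.U]).length := by simp
      rw [hw, this, hl, List.take_length_add_append, List.take_append_of_le_length (by omega)]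
      simp
    rw [e, stepSum_append, stepSum_append]
    have := hP q (by omega)
    have h3 : stepSum [DStep.U, DStep.U] = 2 := by simp [stepSum, DStep.val]
    omega
  have hend : stepSum ((eta d n S).take (d * j + (s + 2))) = stepSum pre := by
    have e : d * j + (s + 2) = (pre ++ [DStep.U, DStep.U] ++ P ++ [DStep.D, DStep.D]).length := by
      simp; omega
    rw [hw, e, List.take_left, stepSum_append, stepSum_append, stepSum_append, hP0]
    simp [stepSum, DStep.val]
  have a1 := stepSum_take hS i t (by omega) (by omega)
  have a2 := stepSum_take hS j (s + 2) (by omega) (by omega)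
  have m1 := Hset_eq_M_add_l hS i
  have m2 := Hset_eq_M_add_l hS j
  rw [hpre] at a1
  rw [hend] at a2
  have hnn : 0 ≤ stepSum pre := by omega
  obtain ⟨g, hg⟩ := Int.eq_ofNat_of_zero_le hnn
  have mj := Nat.mul_le_mul_left d (show i + 1 ≤ j by omega)
  rw [mul_add] at mj
  refine core hS (i + 1) (j + 1) (g + 2) (by omega) (by omega) (by omega) ?_ ?_
  · have b := stepSum_take hS (i + 1) 0 (by omega) (by omega)
    have b2 := hmid (d * (i + 1) + 0) (by rw [mul_add]; omega) (by rw [mul_add]; omega)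
    omega
  · intro v hv1 hv2
    obtain ⟨v, rfl⟩ : ∃ u, v = u + 1 := ⟨v - 1, by omega⟩
    have degv := deg_le hS (v + 1)
    have mv := Nat.mul_le_mul_left d (show i + 1 ≤ v by omega)
    have mv2 := Nat.mul_le_mul_left d (show v + 1 ≤ j by omega)
    rw [mul_add] at mv mv2
    have b := stepSum_take hS v (ldeg S (v + 1)) (by omega) (by omega)
    have b2 := hmid (d * v + ldeg S (v + 1)) (by omega) (by omega)
    have m3 := Hset_eq_M_add_l hS v
    omega
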